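/- Let (ιₖ, pₖ)_{k∈ℤ} be an admissible sequence and define, for each i ∈ I, θᵢ := min{k ∈ ℤ≥1 : ιₖ = i} and ξᵢ := p_{θᵢ}. If i, j ∈ I satisfy i ∼ j and dᵢ = dⱼ, then |ξᵢ − ξⱼ| = dᵢ (this is condition (i) in the definition of a height function on (Δ,σ)). -/

import Mathlib

open Set

variable {I : Type*} [Fintype I]

/-- The cardinality `dᵢ` of the `⟨σ⟩`-orbit of `i`. -/
noncomputable def orbSize (σ : Equiv.Perm I) (i : I) : ℕ :=
  Nat.card {j : I | ∃ k : ℤ, (σ ^ k) i = j}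

/-- `s⁺ = min {t | s < t, ι t = ι s}`. -/
noncomputable def splus (ιs : ℤ → I) (s : ℤ) : ℤ := sInf {t : ℤ | s < t ∧ ιs t = ιs s}

/-- `s⁻ = max {t | t < s, ι t = ι s}`. -/
noncomputable def sminus (ιs : ℤ → I) (s : ℤ) : ℤ := sSup {t : ℤ | t < s ∧ ιs t = ιs s}

/-- An admissible sequence `(ιₖ, pₖ)_{k ∈ ℤ}` in `I × ℤ`, with respect to a finite simple
graph `Δ` on `I` and an automorphism `σ` of `Δ`. -/
structure IsAdmissibleSeq (Δ : SimpleGraph I) (σ : Equiv.Perm I)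
    (ιs : ℤ → I) (p : ℤ → ℤ) : Prop where
  /-- `σ` is an automorphism of `Δ`. -/
  adj_iff : ∀ i j : I, Δ.Adj (σ i) (σ j) ↔ Δ.Adj i j
  /-- each fiber of `ιs` is unbounded above -/
  unbdd_above : ∀ (i : I) (n : ℤ), ∃ k, n < k ∧ ιs k = i
  /-- each fiber of `ιs` is unbounded below -/
  unbdd_below : ∀ (i : I) (n : ℤ), ∃ k, k < n ∧ ιs k = i
  /-- (a) `p_{s⁺} = pₛ + 2 d_{ιₛ}` -/
  ha : ∀ s : ℤ, p (splus ιs s) = p s + 2 * (orbSize σ (ιs s) : ℤ)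
  /-- (b) `pₜ = pₛ + min(d_{ιₛ}, d_{ιₜ})` whenever `ιₛ ∼ ιₜ` and `t⁻ < s < t < s⁺` -/
  hb : ∀ s t : ℤ, Δ.Adj (ιs s) (ιs t) → sminus ιs t < s → s < t → t < splus ιs s →
        p t = p s + min (orbSize σ (ιs s) : ℤ) (orbSize σ (ιs t) : ℤ)
  /-- (c) `pₜ − (pₛ + 2) ∈ 2 d_{ιₛ} ℤ` whenever `ιₜ = σ(ιₛ)` -/
  hc : ∀ s t : ℤ, ιs t = σ (ιs s) → (2 * (orbSize σ (ιs s) : ℤ)) ∣ (p t - (p s + 2))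

/-- `θᵢ = min {k ∈ ℤ≥1 | ιₖ = i}`. -/
noncomputable def theta (ιs : ℤ → I) (i : I) : ℤ := sInf {k : ℤ | 1 ≤ k ∧ ιs k = i}

/-- `ξᵢ = p_{θᵢ}`, the height function attached to the admissible sequence. -/
noncomputable def xi (ιs : ℤ → I) (p : ℤ → ℤ) (i : I) : ℤ := p (theta ιs i)

theorem orbSize_pos (σ : Equiv.Perm I) (i : I) : 0 < orbSize σ i := by
  have : Nonempty {j : I | ∃ k : ℤ, (σ ^ k) i = j} := ⟨⟨i, 0, by simp⟩⟩
  exact Nat.card_pos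

theorem Int.isLeast_csInf {S : Set ℤ} (hne : S.Nonempty) (hb : BddBelow S) :
    IsLeast S (sInf S) :=
  ⟨Int.csInf_mem hne hb, fun _ hx => csInf_le hb hx⟩

theorem Int.isGreatest_csSup {S : Set ℤ} (hne : S.Nonempty) (hb : BddAbove S) :
    IsGreatest S (sSup S) :=
  ⟨Int.csSup_mem hne hb, fun _ hx => le_csSup hb hx⟩

namespace IsAdmissibleSeq

variable {Δ : SimpleGraph I} {σ : Equiv.Perm I} {ιs : ℤ → I} {p : ℤ → ℤ}

theorem isLeast_firstAfter (h : IsAdmissibleSeq Δ σ ιs p) (i : I) (n : ℤ) :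
    IsLeast {k : ℤ | n < k ∧ ιs k = i} (sInf {k : ℤ | n < k ∧ ιs k = i}) :=
  Int.isLeast_csInf (h.unbdd_above i n) ⟨n, fun _ hx => hx.1.le⟩

theorem isGreatest_lastBefore (h : IsAdmissibleSeq Δ σ ιs p) (i : I) (n : ℤ) :
    IsGreatest {k : ℤ | k < n ∧ ιs k = i} (sSup {k : ℤ | k < n ∧ ιs k = i}) :=
  Int.isGreatest_csSup (h.unbdd_below i n) ⟨n, fun _ hx => hx.1.le⟩

theorem isLeast_splus (h : IsAdmissibleSeq Δ σ ιs p) (s : ℤ) :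
    IsLeast {t : ℤ | s < t ∧ ιs t = ιs s} (splus ιs s) :=
  h.isLeast_firstAfter (ιs s) s

theorem isGreatest_sminus (h : IsAdmissibleSeq Δ σ ιs p) (s : ℤ) :
    IsGreatest {t : ℤ | t < s ∧ ιs t = ιs s} (sminus ιs s) :=
  h.isGreatest_lastBefore (ιs s) s

theorem isLeast_theta (h : IsAdmissibleSeq Δ σ ιs p) (i : I) :
    IsLeast {k : ℤ | 1 ≤ k ∧ ιs k = i} (theta ιs i) :=
  h.isLeast_firstAfter i 0

theorem splus_sminus (h : IsAdmissibleSeq Δ σ ιs p) (t : ℤ) :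
    splus ιs (sminus ιs t) = t := by
  obtain ⟨⟨hlt, heq⟩, hmax⟩ := h.isGreatest_sminus t
  obtain ⟨⟨hlt', heq'⟩, hmin⟩ := h.isLeast_splus (sminus ιs t)
  refine le_antisymm (hmin ⟨hlt, heq.symm⟩) ?_
  by_contra! hc
  exact absurd (hmax ⟨hc, heq'.trans heq⟩) (not_le.mpr hlt')

/-- Along each fiber of `ιs`, the sequence `p` is strictly increasing. -/
theorem p_lt_of_lt (h : IsAdmissibleSeq Δ σ ιs p) {a b : ℤ} (hab : a < b)
    (heq : ιs b = ιs a) : p a < p b := by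
  obtain ⟨⟨hlt, hs⟩, hmin⟩ := h.isLeast_splus a
  have hstep : p a < p (splus ιs a) := by
    have := orbSize_pos σ (ιs a)
    rw [h.ha a]
    omega
  rcases (hmin ⟨hab, heq⟩ : splus ιs a ≤ b).eq_or_lt with he | hl
  · rwa [he] at hstep
  · exact hstep.trans (h.p_lt_of_lt hl (heq.trans hs.symm))
termination_by (b - a).toNat
decreasing_by omega

/-- Between two consecutive occurrences of `ιs t` there is at most one occurrence of an adjacent
vertex whose orbit has the same size. -/
theorem lt_splus (h : IsAdmissibleSeq Δ σ ιs p) {s t : ℤ} (hadj : Δ.Adj (ιs s) (ιs t))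
    (hd : orbSize σ (ιs s) = orbSize σ (ιs t)) (hts : sminus ιs t < s) (hst : s < t) :
    t < splus ιs s := by
  by_contra! hle
  obtain ⟨⟨hsp, hsι⟩, -⟩ := h.isLeast_splus s
  obtain ⟨⟨-, huι⟩, -⟩ := h.isGreatest_sminus t
  have hut := h.splus_sminus t
  have hpt := h.ha (sminus ιs t)
  generalize hu : sminus ιs t = u at *
  rw [hut, huι] at hpt
  have hne : splus ιs s ≠ t := fun he => hadj.ne (by rw [← hsι, he])
  obtain ⟨⟨huv, hvι⟩, hvmin⟩ := h.isLeast_firstAfter (ιs s) u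
  obtain ⟨⟨hwt, hwι⟩, hwmax⟩ := h.isGreatest_lastBefore (ιs s) t
  generalize sInf {k : ℤ | u < k ∧ ιs k = ιs s} = v at *
  generalize sSup {k : ℤ | k < t ∧ ιs k = ιs s} = w at *
  have hvs : v ≤ s := hvmin ⟨hts, rfl⟩
  have hsw : splus ιs s ≤ w := hwmax ⟨lt_of_le_of_ne hle hne, hsι⟩
  have hv_minus : sminus ιs v < u := by
    obtain ⟨⟨hlt, heq⟩, -⟩ := h.isGreatest_sminus v
    by_contra! hc
    rcases hc.eq_or_lt with he | hl
    · exact hadj.ne (by rw [← huι, he, heq, hvι])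
    · exact absurd (hvmin ⟨hl, heq.trans hvι⟩) (not_le.mpr hlt)
  have hw_plus : t < splus ιs w := by
    obtain ⟨⟨hlt, heq⟩, -⟩ := h.isLeast_splus w
    by_contra! hc
    rcases hc.eq_or_lt with he | hl
    · exact hadj.ne (by rw [← he, heq, hwι])
    · exact absurd (hwmax ⟨hl, heq.trans hwι⟩) (not_le.mpr hlt)
  have hpv := h.hb u v (by rw [huι, hvι]; exact hadj.symm) hv_minus huv (by omega)
  have hpw := h.hb w t (by rwa [hwι]) (by omega) hwt hw_plus
  have hlt := h.p_lt_of_lt (show v < w by omega) (hwι.trans hvι.symm)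
  rw [huι, hvι, hd, min_self] at hpv
  rw [hwι, hd, min_self] at hpw
  omega

theorem xi_eq_add_of_theta_lt (h : IsAdmissibleSeq Δ σ ιs p) {i j : I} (hadj : Δ.Adj i j)
    (hd : orbSize σ i = orbSize σ j) (hlt : theta ιs i < theta ιs j) :
    xi ιs p j = xi ιs p i + orbSize σ i := by
  obtain ⟨⟨hi1, hi⟩, -⟩ := h.isLeast_theta i
  obtain ⟨⟨-, hj⟩, hjmin⟩ := h.isLeast_theta j
  obtain ⟨⟨hm, hmι⟩, -⟩ := h.isGreatest_sminus (theta ιs j)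
  have hminus : sminus ιs (theta ιs j) < theta ιs i := by
    by_contra! hc
    exact absurd (hjmin ⟨hi1.trans hc, hmι.trans hj⟩) (not_le.mpr hm)
  have hadj' : Δ.Adj (ιs (theta ιs i)) (ιs (theta ιs j)) := by rwa [hi, hj]
  have hb := h.hb _ _ hadj' hminus hlt (h.lt_splus hadj' (by rw [hi, hj, hd]) hminus hlt)
  rwa [hi, hj, hd, min_self, ← hd] at hb

end IsAdmissibleSeq

theorem stmt16 (Δ : SimpleGraph I) (σ : Equiv.Perm I) (ιs : ℤ → I) (p : ℤ → ℤ)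
    (h : IsAdmissibleSeq Δ σ ιs p) (i j : I) (hadj : Δ.Adj i j)
    (hd : orbSize σ i = orbSize σ j) :
    |xi ιs p i - xi ιs p j| = (orbSize σ i : ℤ) := by
  have hne : theta ιs i ≠ theta ιs j := fun he => hadj.ne <| by
    rw [← (h.isLeast_theta i).1.2, he, (h.isLeast_theta j).1.2]
  rcases hne.lt_or_gt with hlt | hlt
  · simp [h.xi_eq_add_of_theta_lt hadj hd hlt]
  · simp [h.xi_eq_add_of_theta_lt hadj.symm hd.symm hlt, hd]
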